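/- Let G be a (P2∪P4)-free simple graph, let v be a vertex of G, let v' be a neighbor of v, and let H be an induced complement of a cycle on k ≥ 7 vertices (an antihole) with all vertices of H nonadjacent to v and distinct from v. Then v' has at least two neighbors in V(H). -/

import Mathlib

open SimpleGraph

/-- `H` is (isomorphic to) an induced subgraph of `G`. -/
def ContainsInduced {α β : Type*} (H : SimpleGraph α) (G : SimpleGraph β) : Prop :=
  ∃ f : α ↪ β, ∀ a b : α, G.Adj (f a) (f b) ↔ H.Adj a b

/-- The disjoint union `P2 ∪ P4`. -/
def P2UnionP4 : SimpleGraph (Fin 6) :=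
  SimpleGraph.fromEdgeSet {s(0,1), s(2,3), s(3,4), s(4,5)}

/-- The bull: a triangle with two disjoint pendant edges. -/
def BullGraph : SimpleGraph (Fin 5) :=
  SimpleGraph.fromEdgeSet {s(0,1), s(0,2), s(1,2), s(0,3), s(1,4)}

/-- The triangle `C3`. -/
def TriangleGraph : SimpleGraph (Fin 3) := ⊤

/-- The paw: a triangle with a pendant edge. -/
def PawGraph : SimpleGraph (Fin 4) :=
  SimpleGraph.fromEdgeSet {s(0,1), s(0,2), s(1,2), s(0,3)}

/-- The diamond: `K4` minus an edge. -/
def DiamondGraph : SimpleGraph (Fin 4) :=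
  SimpleGraph.fromEdgeSet {s(0,1), s(0,2), s(0,3), s(1,2), s(1,3)}

/-- The 5-cycle. -/
def Cycle5 : SimpleGraph (Fin 5) :=
  SimpleGraph.fromEdgeSet {s(0,1), s(1,2), s(2,3), s(3,4), s(0,4)}

/-- The 7-cycle. -/
def Cycle7 : SimpleGraph (Fin 7) :=
  SimpleGraph.fromEdgeSet {s(0,1), s(1,2), s(2,3), s(3,4), s(4,5), s(5,6), s(0,6)}

/-- The Grötzsch graph `F1`: vertex `0` is `v`, vertices `1,…,5` are `w1,…,w5`,
vertices `6,…,10` are `v1,…,v5`; `v` is adjacent exactly to the `wᵢ`, the `vᵢ` form a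
5-cycle, and `wᵢ` is adjacent exactly to `v`, `vᵢ` and `vᵢ₊₂` (indices mod 5). -/
def GrotzschGraph : SimpleGraph (Fin 11) :=
  SimpleGraph.fromEdgeSet
    {s(0,1), s(0,2), s(0,3), s(0,4), s(0,5),
     s(6,7), s(7,8), s(8,9), s(9,10), s(6,10),
     s(1,6), s(1,8), s(2,7), s(2,9), s(3,8), s(3,10), s(4,9), s(4,6), s(5,10), s(5,7)}

/-- The Clebsch graph `F2`: vertices are the elements of `(ℤ/2)⁴`, two vertices adjacent
iff their difference is one of `e1, e2, e3, e4, e1+e2+e3+e4`. -/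
def ClebschGraph : SimpleGraph (Fin 4 → ZMod 2) :=
  SimpleGraph.fromRel (fun x y =>
    x - y ∈ ({Pi.single 0 1, Pi.single 1 1, Pi.single 2 1, Pi.single 3 1, 1} :
      Set (Fin 4 → ZMod 2)))

/-- A graph is perfect if every induced subgraph has chromatic number equal to clique number. -/
def SimpleGraph.IsPerfect {V : Type*} (G : SimpleGraph V) : Prop :=
  ∀ S : Set V, (G.induce S).chromaticNumber = ((G.induce S).cliqueNum : ℕ∞)

/-- A graph is perfectly divisible if each nonempty induced subgraph `H` has a partition
`(A, B)` of its vertex set such that `H[A]` is perfect and `ω(H[B]) < ω(H)`. -/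
def SimpleGraph.PerfectlyDivisible {V : Type*} (G : SimpleGraph V) : Prop :=
  ∀ S : Set V, S.Nonempty → ∃ A B : Set V, A ∪ B = S ∧ A ∩ B = ∅ ∧
    (G.induce A).IsPerfect ∧ (G.induce B).cliqueNum < (G.induce S).cliqueNum

/-- An edge `xy` together with an anticomplete induced path `p q r s` is an induced `P2 ∪ P4`. -/
theorem containsInduced_P2UnionP4 {V : Type*} {G : SimpleGraph V} {x y p q r s : V}
    (hxy : G.Adj x y) (hpq : G.Adj p q) (hqr : G.Adj q r) (hrs : G.Adj r s)
    (hpr : ¬ G.Adj p r) (hps : ¬ G.Adj p s) (hqs : ¬ G.Adj q s)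
    (hx : ∀ z ∈ [p, q, r, s], ¬ G.Adj x z) (hy : ∀ z ∈ [p, q, r, s], ¬ G.Adj y z) :
    ContainsInduced P2UnionP4 G := by
  simp only [List.forall_mem_cons, List.not_mem_nil, false_imp_iff, implies_true, and_true]
    at hx hy
  have hadj : ∀ a b : Fin 6, G.Adj (![x, y, p, q, r, s] a) (![x, y, p, q, r, s] b) ↔
      P2UnionP4.Adj a b := by
    intro a b
    fin_cases a <;> fin_cases b <;> simp [P2UnionP4, G.adj_comm] <;> grind [SimpleGraph.adj_comm]
  refine ⟨⟨![x, y, p, q, r, s], fun a b hab => ?_⟩, hadj⟩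
  have key : ∀ d, P2UnionP4.Adj a d ↔ P2UnionP4.Adj b d := fun d => by
    rw [← hadj, ← hadj, hab]
  have h0 := key 0
  have h1 := key 1
  have h2 := key 2
  have h3 := key 3
  have h4 := key 4
  have h5 := key 5
  clear key hab hadj
  revert h0 h1 h2 h3 h4 h5
  fin_cases a <;> fin_cases b <;> simp [P2UnionP4]

theorem statement_18 {V : Type*} [Fintype V] (G : SimpleGraph V)
    (hP : ¬ ContainsInduced P2UnionP4 G)
    (v v' : V) (hv' : G.Adj v v')
    (k : ℕ) (hk : 7 ≤ k) (c : ZMod k → V) (hinj : Function.Injective c)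
    (hM : ∀ i, c i ≠ v ∧ ¬ G.Adj v (c i))
    (hH : ∀ i j, G.Adj (c i) (c j) ↔ (i ≠ j ∧ ¬ (j = i + 1 ∨ i = j + 1))) :
    ∃ i j : ZMod k, i ≠ j ∧ G.Adj v' (c i) ∧ G.Adj v' (c j) := by
  by_contra! hcon
  obtain ⟨a, ha⟩ : ∃ a : ZMod k, ∀ i, i ≠ a → ¬ G.Adj v' (c i) := by
    by_cases h : ∃ a, G.Adj v' (c a)
    · obtain ⟨a, ha⟩ := h
      exact ⟨a, fun i hi => hcon a i hi.symm ha⟩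
    · exact ⟨0, fun i _ hi => h ⟨i, hi⟩⟩
  have hne : ∀ n : ℕ, 0 < n → n < 7 → (n : ZMod k) ≠ 0 := fun n h0 h7 h =>
    absurd (Nat.le_of_dvd h0 ((ZMod.natCast_eq_zero_iff n k).1 h)) (by omega)
  have h1 := hne 1 (by norm_num) (by norm_num)
  have h2 := hne 2 (by norm_num) (by norm_num)
  have h3 := hne 3 (by norm_num) (by norm_num)
  have h4 := hne 4 (by norm_num) (by norm_num)
  push_cast at h1 h2 h3 h4
  have hcc : ∀ m n : ZMod k, G.Adj (c (a + m)) (c (a + n)) ↔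
      m - n ≠ 0 ∧ m - n + 1 ≠ 0 ∧ m - n - 1 ≠ 0 := fun m n => by
    rw [hH, not_or]
    refine and_congr (not_congr ?_) (and_congr (not_congr ?_) (not_congr ?_)) <;>
      constructor <;> intro h <;> first | linear_combination h | linear_combination -h
  have hy : ∀ n : ZMod k, n ≠ 0 → ¬ G.Adj v' (c (a + n)) := fun n hn => ha _ (by simpa using hn)
  refine hP (containsInduced_P2UnionP4 (p := c (a + 2)) (q := c (a + 4)) (r := c (a + 1))
    (s := c (a + 3)) hv' ?_ ?_ ?_ ?_ ?_ ?_ (by simp [hM]) (by simp [hy, h1, h2, h3, h4])) <;>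
  · rw [hcc]
    norm_num [h1, h2, h3, h4]
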